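/- arXiv:1007.2899 — 8 statements merged into one kernel-verified Lean document; each statement's English description precedes it below -/
import Mathlib

section
/- Let n be an even positive integer and let h ∈ Q. Then there is exactly one permutation π ∈ P0 such that h ∈ Q_π (i.e., such that h and π differ at exactly one point); moreover, the unique point at which this π and h differ is the even element of the colliding pair of h (the even element j with h(j) = 1). -/
/- `Fin n` models `[n] = {1, …, n}`: the element `i : Fin n` represents the
integer `i.val + 1`, so `⟨0, hn⟩` represents the element `1`. -/

/-- `P0`: permutations `π` of `[n]` such that `π⁻¹(1)` is odd. -/
def P0 (n : ℕ) (hn : 0 < n) : Finset (Equiv.Perm (Fin n)) :=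
  Finset.univ.filter fun π => Odd ((π.symm ⟨0, hn⟩ : Fin n).val + 1)

/-- `P1`: permutations `π` of `[n]` such that `π⁻¹(1)` is even. -/
def P1 (n : ℕ) (hn : 0 < n) : Finset (Equiv.Perm (Fin n)) :=
  Finset.univ.filter fun π => Even ((π.symm ⟨0, hn⟩ : Fin n).val + 1)

/-- `Q`: functions `h : [n] → [n]` whose preimage of `1` has exactly two
elements, exactly one of which is odd, and such that every value other
than `1` has at most one preimage (a unique collision, at the value `1`,
with one odd and one even element in the colliding pair). -/
def Qset (n : ℕ) (hn : 0 < n) : Finset (Fin n → Fin n) :=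
  Finset.univ.filter fun h =>
    (Finset.univ.filter fun i => h i = (⟨0, hn⟩ : Fin n)).card = 2 ∧
    (Finset.univ.filter fun i => h i = (⟨0, hn⟩ : Fin n) ∧ Odd (i.val + 1)).card = 1 ∧
    ∀ y : Fin n, y ≠ ⟨0, hn⟩ → (Finset.univ.filter fun i => h i = y).card ≤ 1

/-- `Q_π`: functions in `Q` that differ from the permutation `π` in exactly
one point. -/
def Qpi (n : ℕ) (hn : 0 < n) (π : Equiv.Perm (Fin n)) : Finset (Fin n → Fin n) :=
  (Qset n hn).filter fun h => (Finset.univ.filter fun i => h i ≠ π i).card = 1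

/-- A function in `Q` has an odd element `a` and an even element `b` such that `{a, b}` is the
fibre over `1`, and it is injective away from `1`. -/
theorem exists_collision_of_mem_Qset {n : ℕ} {hn : 0 < n} {h : Fin n → Fin n}
    (hQ : h ∈ Qset n hn) :
    ∃ a b : Fin n, Odd (a.val + 1) ∧ Even (b.val + 1) ∧
      (∀ i, h i = ⟨0, hn⟩ ↔ i = a ∨ i = b) ∧
      ∀ i j, h i = h j → h i ≠ ⟨0, hn⟩ → i = j := by
  obtain ⟨-, hcard, hodd, hinj⟩ := Finset.mem_filter.1 hQ
  have inj : ∀ i j, h i = h j → h i ≠ ⟨0, hn⟩ → i = j := fun i j hij hi =>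
    Finset.card_le_one.1 (hinj _ hi) i (by simp) j (by simp [hij])
  obtain ⟨a, ha⟩ := Finset.card_eq_one.1 hodd
  have odd_iff : ∀ i, (h i = ⟨0, hn⟩ ∧ Odd (i.val + 1)) ↔ i = a := fun i => by
    simpa using congrArg (i ∈ ·) ha
  obtain ⟨ha1, ha_odd⟩ := (odd_iff a).2 rfl
  obtain ⟨x, y, hxy, hset⟩ := Finset.card_eq_two.1 hcard
  have fibre : ∀ i, h i = ⟨0, hn⟩ ↔ i = x ∨ i = y := fun i => by
    simpa using congrArg (i ∈ ·) hset
  have even_of_ne : ∀ i, h i = ⟨0, hn⟩ → i ≠ a → Even (i.val + 1) := fun i hi hne =>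
    Nat.not_odd_iff_even.1 fun ho => hne ((odd_iff i).1 ⟨hi, ho⟩)
  rcases (fibre a).1 ha1 with rfl | rfl
  · exact ⟨a, y, ha_odd, even_of_ne y ((fibre y).2 (.inr rfl)) hxy.symm, fibre, inj⟩
  · exact ⟨a, x, ha_odd, even_of_ne x ((fibre x).2 (.inl rfl)) hxy,
      fun i => (fibre i).trans or_comm, inj⟩

/-- Two permutations that agree away from one point are equal. -/
theorem Equiv.Perm.eq_of_forall_ne {α : Type*} {π σ : Equiv.Perm α} (b : α)
    (H : ∀ i, i ≠ b → π i = σ i) : π = σ := by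
  ext i
  by_cases hi : i = b
  · subst hi
    obtain ⟨x, hx⟩ := σ.surjective (π i)
    by_cases hxi : x = i
    · rw [← hx, hxi]
    · exact absurd (π.injective ((H x hxi).trans hx)) hxi
  · rw [H i hi]

/-- For an even positive integer `n` and `h ∈ Q`, there is exactly one
permutation `π ∈ P0` with `h ∈ Q_π`; moreover, the unique point at which
such a `π` and `h` differ is the even element `j` of the colliding pair of
`h` (so `h j = 1` and `j` is even). -/
theorem unique_P0_perm_of_mem_Q (n : ℕ) (hn : 0 < n) (hne : Even n)
    (h : Fin n → Fin n) (hQ : h ∈ Qset n hn) :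
    (∃! π : Equiv.Perm (Fin n), π ∈ P0 n hn ∧ h ∈ Qpi n hn π) ∧
    (∀ π : Equiv.Perm (Fin n), π ∈ P0 n hn → h ∈ Qpi n hn π →
      ∀ j : Fin n, h j ≠ π j → h j = (⟨0, hn⟩ : Fin n) ∧ Even (j.val + 1)) := by
  obtain ⟨a, b, ha, hb, fibre, inj⟩ := exists_collision_of_mem_Qset hQ
  have hab : a ≠ b := by
    rintro rfl
    exact Nat.not_even_iff_odd.2 ha hb
  have ha1 : h a = ⟨0, hn⟩ := (fibre a).2 (.inl rfl)
  have hb1 : h b = ⟨0, hn⟩ := (fibre b).2 (.inr rfl)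
  have differ : ∀ π : Equiv.Perm (Fin n), π ∈ P0 n hn → h ∈ Qpi n hn π →
      ∀ j, h j ≠ π j → j = b := by
    intro π hπ hh j hj
    have hone := Finset.card_le_one.1 (Finset.mem_filter.1 hh).2.le
    by_contra hjb
    have agree : h b = π b := by
      by_contra hbne
      exact hjb (hone j (by simpa using hj) b (by simpa using hbne))
    have hsymm : π.symm ⟨0, hn⟩ = b := by rw [Equiv.symm_apply_eq, ← agree, hb1]
    have hodd := (Finset.mem_filter.1 hπ).2
    rw [hsymm] at hodd
    exact Nat.not_even_iff_odd.2 hodd hb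
  refine ⟨?_, fun π hπ hh j hj => ?_⟩
  · have hsurj : ¬ Function.Surjective h := fun hs =>
      hab (Finite.injective_iff_surjective.2 hs (ha1.trans hb1.symm))
    obtain ⟨z, hz⟩ : ∃ z, ∀ i, h i ≠ z := by simpa [Function.Surjective] using hsurj
    have hupd : Function.Injective (Function.update h b z) := by
      intro i j hij
      by_cases hi : i = b <;> by_cases hj : j = b
      · rw [hi, hj]
      · subst hi
        simp only [Function.update_self, Function.update_of_ne hj] at hij
        exact absurd hij.symm (hz j)
      · subst hj
        simp only [Function.update_self, Function.update_of_ne hi] at hij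
        exact absurd hij (hz i)
      · rw [Function.update_of_ne hi, Function.update_of_ne hj] at hij
        by_cases h1 : h i = ⟨0, hn⟩
        · rw [((fibre i).1 h1).resolve_right hi,
            ((fibre j).1 (hij.symm.trans h1)).resolve_right hj]
        · exact inj i j hij h1
    let π : Equiv.Perm (Fin n) :=
      Equiv.ofBijective _ (Finite.injective_iff_bijective.1 hupd)
    have hπ_apply : ∀ i, π i = Function.update h b z i := fun _ => rfl
    have hsymm : π.symm ⟨0, hn⟩ = a := by
      rw [Equiv.symm_apply_eq, hπ_apply, Function.update_of_ne hab, ha1]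
    have hπ : π ∈ P0 n hn := Finset.mem_filter.2 ⟨Finset.mem_univ _, by rwa [hsymm]⟩
    have hh : h ∈ Qpi n hn π := by
      refine Finset.mem_filter.2 ⟨hQ, Finset.card_eq_one.2 ⟨b, ?_⟩⟩
      ext i
      by_cases hi : i = b
      · subst hi
        simp [hπ_apply, hz]
      · simp [hπ_apply, hi]
    refine ⟨π, ⟨hπ, hh⟩, fun σ hσ => Equiv.Perm.eq_of_forall_ne b fun i hi => ?_⟩
    rw [← not_not.1 (mt (differ σ hσ.1 hσ.2 i) hi), ← not_not.1 (mt (differ π hπ hh i) hi)]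
  · rw [differ π hπ hh j hj]
    exact ⟨hb1, hb⟩
end

section
/- Let n be an even positive integer and let h ∈ Q. Then there is exactly one permutation π ∈ P1 such that h ∈ Q_π (i.e., such that h and π differ at exactly one point); moreover, the unique point at which this π and h differ is the odd element of the colliding pair of h (the odd element i with h(i) = 1). -/
/-- A self-map of a finite type that is injective away from `a` agrees away from `a` with some
permutation. -/
theorem Set.InjOn.exists_perm_eq_off {α : Type*} [Finite α] {f : α → α} {a : α}
    (hf : Set.InjOn f {a}ᶜ) : ∃ π : Equiv.Perm α, ∀ i, i ≠ a → π i = f i := by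
  classical
  have := Fintype.ofFinite α
  obtain ⟨g, hg⟩ := Finset.exists_equiv_extend_of_card_eq (t := (Finset.univ : Finset α))
    (s := {a}ᶜ) (f := f) (Finset.card_univ (α := α)).symm (Finset.subset_univ _)
    (by simpa using hf)
  exact ⟨g.trans (Equiv.subtypeUnivEquiv Finset.mem_univ), fun i hi => hg i (by simpa using hi)⟩

/-- Two permutations that agree away from one point are equal. -/
theorem Equiv.Perm.eq_of_eq_off {α : Type*} {π σ : Equiv.Perm α} (a : α)
    (h : ∀ i, i ≠ a → π i = σ i) : π = σ := by
  have key : ∀ i, i ≠ a → σ.symm (π i) = i := fun i hi => by simp [h i hi]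
  ext i
  by_cases hi : i = a
  · subst hi
    by_contra hne
    have hne' : σ.symm (π i) ≠ i := fun e => hne (by rw [← e, σ.apply_symm_apply, e])
    exact hne' (π.injective (σ.symm.injective (key _ hne')))
  · exact h i hi

/-- The colliding pair of a function in `Q`: an odd element `a` and an even element `b`. -/
theorem exists_colliding_pair_of_mem_Qset {n : ℕ} {hn : 0 < n} {h : Fin n → Fin n}
    (hQ : h ∈ Qset n hn) :
    ∃ a b : Fin n, Odd (a.val + 1) ∧ Even (b.val + 1) ∧
      (∀ i, h i = ⟨0, hn⟩ ↔ i = a ∨ i = b) ∧ Set.InjOn h {a}ᶜ := by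
  simp only [Qset, Finset.mem_filter, Finset.mem_univ, true_and] at hQ
  obtain ⟨hpair, hodd, hinj⟩ := hQ
  obtain ⟨a, ha⟩ := Finset.card_eq_one.mp hodd
  simp only [Finset.ext_iff, Finset.mem_filter, Finset.mem_univ, true_and,
    Finset.mem_singleton] at ha
  obtain ⟨ha1, haodd⟩ := (ha a).mpr rfl
  obtain ⟨x, y, hxy, hset⟩ := Finset.card_eq_two.mp hpair
  simp only [Finset.ext_iff, Finset.mem_filter, Finset.mem_univ, true_and, Finset.mem_insert,
    Finset.mem_singleton] at hset
  obtain ⟨b, hba, hb⟩ : ∃ b, b ≠ a ∧ ∀ i, h i = ⟨0, hn⟩ ↔ i = a ∨ i = b := by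
    rcases (hset a).mp ha1 with rfl | rfl
    · exact ⟨y, hxy.symm, hset⟩
    · exact ⟨x, hxy, fun i => (hset i).trans or_comm⟩
  refine ⟨a, b, haodd, ?_, hb, fun i hi j hj hij => ?_⟩
  · rw [← Nat.not_odd_iff_even]
    exact fun hbodd => hba ((ha b).mp ⟨(hb b).mpr (Or.inr rfl), hbodd⟩)
  · by_cases hi1 : h i = ⟨0, hn⟩
    · rw [((hb i).mp hi1).resolve_left hi, ((hb j).mp (hij ▸ hi1)).resolve_left hj]
    · exact Finset.card_le_one.mp (hinj _ hi1) i (by simp) j (by simp [hij])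

/-- For an even positive integer `n` and `h ∈ Q`, there is exactly one
permutation `π ∈ P1` with `h ∈ Q_π`; moreover, the unique point at which
such a `π` and `h` differ is the odd element `i` of the colliding pair of
`h` (so `h i = 1` and `i` is odd). -/
theorem unique_P1_perm_of_mem_Q (n : ℕ) (hn : 0 < n) (hne : Even n)
    (h : Fin n → Fin n) (hQ : h ∈ Qset n hn) :
    (∃! π : Equiv.Perm (Fin n), π ∈ P1 n hn ∧ h ∈ Qpi n hn π) ∧
    (∀ π : Equiv.Perm (Fin n), π ∈ P1 n hn → h ∈ Qpi n hn π →
      ∀ i : Fin n, h i ≠ π i → h i = (⟨0, hn⟩ : Fin n) ∧ Odd (i.val + 1)) := by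
  obtain ⟨a, b, haodd, hbeven, hab, hinj⟩ := exists_colliding_pair_of_mem_Qset hQ
  have ha : h a = ⟨0, hn⟩ := (hab a).mpr (Or.inl rfl)
  have hb : h b = ⟨0, hn⟩ := (hab b).mpr (Or.inr rfl)
  have hne_ab : a ≠ b := by
    rintro rfl
    exact Nat.not_even_iff_odd.mpr haodd hbeven
  have differ_only_at : ∀ π : Equiv.Perm (Fin n), π ∈ P1 n hn → h ∈ Qpi n hn π →
      ∀ i, h i ≠ π i → i = a := by
    intro π hπ hhπ i hi
    simp only [P1, Finset.mem_filter, Finset.mem_univ, true_and] at hπ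
    have hcard := (Finset.mem_filter.mp hhπ).2
    have hadiff : h a ≠ π a := by
      intro e
      rw [(π.symm_apply_eq (x := ⟨0, hn⟩) (y := a)).mpr (ha.symm.trans e)] at hπ
      exact Nat.not_even_iff_odd.mpr haodd hπ
    exact Finset.card_le_one.mp hcard.le i (by simpa using hi) a (by simpa using hadiff)
  refine ⟨?_, fun π hπ hhπ i hi => ?_⟩
  · obtain ⟨π, hπ⟩ := hinj.exists_perm_eq_off
    have hπb : π b = ⟨0, hn⟩ := (hπ b hne_ab.symm).trans hb
    have hdiff : ∀ i, h i ≠ π i ↔ i = a := by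
      refine fun i => ⟨fun hi => by_contra fun hia => hi (hπ i hia).symm, ?_⟩
      rintro rfl e
      exact hne_ab (π.injective (e.symm.trans (ha.trans hπb.symm)))
    have hπP1 : π ∈ P1 n hn := by
      simp only [P1, Finset.mem_filter, Finset.mem_univ, true_and]
      rwa [π.symm_apply_eq.mpr hπb.symm]
    have hhπ : h ∈ Qpi n hn π := by
      refine Finset.mem_filter.mpr ⟨hQ, Finset.card_eq_one.mpr ⟨a, ?_⟩⟩
      ext i
      simpa using hdiff i
    refine ⟨π, ⟨hπP1, hhπ⟩, fun σ hσ => Equiv.Perm.eq_of_eq_off a fun i hi => ?_⟩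
    rw [hπ i hi]
    exact (by_contra fun e => hi (differ_only_at σ hσ.1 hσ.2 i (Ne.symm e)))
  · rw [differ_only_at π hπ hhπ i hi]
    exact ⟨ha, haodd⟩
end

section
/- Let n be an even positive integer. Then for every permutation π of [n], the set Q_π has exactly n/2 elements. -/
open Finset in
/-- Among `k + k` consecutive integers starting at `0`, exactly `k` have parity other than `a`. -/
theorem card_filter_mod_two_ne (k a : ℕ) :
    #{j : Fin (k + k) | j.val % 2 ≠ a % 2} = k := by
  rw [← card_range k]
  refine (card_bij (fun i hi ↦ (⟨2 * i + (a + 1) % 2, ?_⟩ : Fin (#(range k) + #(range k))))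
    ?_ ?_ ?_).symm
  · simp only [card_range, mem_range] at hi ⊢
    omega
  · intro i hi
    simp only [mem_filter, mem_univ, true_and]
    omega
  · intro i hi j hj h
    simp only [Fin.mk.injEq] at h
    omega
  · intro j hj
    have hlt := j.isLt
    simp only [card_range, mem_filter, mem_univ, true_and] at hj hlt
    exact ⟨j.val / 2, by rw [mem_range]; omega, Fin.ext (by simp only; omega)⟩

section Update

open Finset Function

variable {α β : Type*} [Fintype α] [DecidableEq α] [DecidableEq β]

/-- Redirecting the point `j` of a bijection to the value `z` makes the fibre over `z` consist
of `j` and the original preimage of `z`. -/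
theorem filter_update_equiv_eq (e : α ≃ β) (j : α) (z : β) :
    ({i | update e j z i = z} : Finset α) = {e.symm z, j} := by
  ext i
  by_cases hij : i = j
  · simp [hij]
  · simp [hij, Equiv.eq_symm_apply]

/-- Redirecting one point of a bijection to `z` creates no collision at a value other than `z`. -/
theorem card_filter_update_equiv_le_one (e : α ≃ β) (j : α) {z y : β} (hy : y ≠ z) :
    #{i | update e j z i = y} ≤ 1 := by
  refine card_le_one.2 fun a ha b hb ↦ ?_
  simp only [mem_filter, mem_univ, true_and, update_apply] at ha hb
  split_ifs at ha hb
  · simp_all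
  · exact absurd ha.symm hy
  · exact absurd hb.symm hy
  · exact e.injective (ha.trans hb.symm)

/-- A map that differs from a bijection in one point only and takes the value `z` twice arises by
redirecting that point to `z`. -/
theorem exists_eq_update_of_card_ne_eq_one (e : α ≃ β) (z : β) (h : α → β)
    (hne : #{i | h i ≠ e i} = 1) (hz : #{i | h i = z} = 2) :
    ∃ j, h = update e j z := by
  obtain ⟨j, hj⟩ := card_eq_one.1 hne
  have hdiff : ∀ i, h i ≠ e i ↔ i = j := fun i ↦ by
    simpa using congrArg (i ∈ ·) hj
  have hoff : ∀ i, i ≠ j → h i = e i := fun i hi ↦ not_not.1 (mt (hdiff i).1 hi)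
  have hjz : h j = z := by
    by_contra hjz
    have : #{i | h i = z} ≤ 1 := card_le_one.2 fun a ha b hb ↦ by
      simp only [mem_filter, mem_univ, true_and] at ha hb
      have haj : a ≠ j := by rintro rfl; exact hjz ha
      have hbj : b ≠ j := by rintro rfl; exact hjz hb
      exact e.injective (by rw [← hoff a haj, ← hoff b hbj, ha, hb])
    omega
  refine ⟨j, funext fun i ↦ ?_⟩
  by_cases hi : i = j
  · simp [hi, hjz]
  · simp [hi, hoff i hi]

end Update

open Finset Function in
/-- Redirecting a point `j` of a permutation to `1` yields a function in `Q` exactly when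
`j` and the preimage of `1` have different parities. -/
theorem update_mem_Qset_iff (n : ℕ) (hn : 0 < n) (π : Equiv.Perm (Fin n)) (j : Fin n) :
    update π j ⟨0, hn⟩ ∈ Qset n hn ↔ j.val % 2 ≠ (π.symm ⟨0, hn⟩).val % 2 := by
  have hfib := filter_update_equiv_eq π j ⟨0, hn⟩
  simp only [Qset, mem_filter, mem_univ, true_and, ← filter_filter, hfib]
  have hle : ∀ y : Fin n, y ≠ ⟨0, hn⟩ → #{i | update π j ⟨0, hn⟩ i = y} ≤ 1 :=
    fun y hy ↦ card_filter_update_equiv_le_one π j hy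
  rw [and_iff_left hle]
  by_cases hj : π.symm ⟨0, hn⟩ = j
  · simp [hj]
  · rw [card_pair hj, filter_insert, filter_singleton]
    simp only [true_and, Nat.odd_iff]
    split_ifs <;> simp [hj] <;> omega

open Finset Function in
/-- `Q_π` consists of the functions obtained from `π` by redirecting to `1` a point whose parity
differs from that of the preimage of `1`. -/
theorem Qpi_eq_image (n : ℕ) (hn : 0 < n) (π : Equiv.Perm (Fin n)) :
    Qpi n hn π = image (fun j ↦ update π j ⟨0, hn⟩)
      {j | j.val % 2 ≠ (π.symm ⟨0, hn⟩).val % 2} := by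
  ext h
  simp only [mem_image, mem_filter, mem_univ, true_and, Qpi]
  constructor
  · rintro ⟨hQ, hne⟩
    have hcard := (mem_filter.1 hQ).2.1
    obtain ⟨j, rfl⟩ := exists_eq_update_of_card_ne_eq_one π _ h hne hcard
    exact ⟨j, (update_mem_Qset_iff n hn π j).1 hQ, rfl⟩
  · rintro ⟨j, hj, rfl⟩
    refine ⟨(update_mem_Qset_iff n hn π j).2 hj, card_eq_one.2 ⟨j, ?_⟩⟩
    ext i
    by_cases hi : i = j
    · subst hi
      have : (⟨0, hn⟩ : Fin n) ≠ π i := fun h0 ↦ hj (by rw [h0, Equiv.symm_apply_apply])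
      simpa using this
    · simp [hi]

/-- For an even positive integer `n` and any permutation `π` of `[n]`,
the set `Q_π` has exactly `n/2` elements. -/
theorem card_Qpi (n : ℕ) (hn : 0 < n) (hne : Even n) (π : Equiv.Perm (Fin n)) :
    (Qpi n hn π).card = n / 2 := by
  rw [Qpi_eq_image, Finset.card_image_of_injOn]
  · obtain ⟨k, rfl⟩ := hne
    rw [card_filter_mod_two_ne]
    omega
  · intro i hi j hj hij
    by_contra hne'
    have h0 : (⟨0, hn⟩ : Fin n) = π i := by simpa [hne'] using congrFun hij i
    simp [h0] at hi
end

section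
/- Let n be an even positive integer. Then the set Q has exactly (n/2)²·(n−1)! elements. -/
/-- The functions whose fibre over `z` is `{a, b}` and which are injective outside that fibre. -/
def collisionFunctions {α β : Type*} [Fintype α] [DecidableEq α] [Fintype β] [DecidableEq β]
    (z : β) (a b : α) : Finset (α → β) :=
  Finset.univ.filter fun h =>
    (∀ i, h i = z ↔ i = a ∨ i = b) ∧ ∀ i j, h i = h j → h i ≠ z → i = j

/-- A function colliding exactly at `a, b` with value `z` is an embedding of the complement of
`{a, b}` into the complement of `{z}`. -/
def collisionFunctionsEquiv {α β : Type*} [Fintype α] [DecidableEq α] [Fintype β] [DecidableEq β]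
    (z : β) (a b : α) :
    {h // h ∈ collisionFunctions z a b} ≃ ({x : α // ¬(x = a ∨ x = b)} ↪ {y : β // y ≠ z}) where
  toFun h :=
    have hh := (Finset.mem_filter.1 h.2).2
    ⟨fun x => ⟨h.1 x, fun e => x.2 ((hh.1 _).1 e)⟩, fun x y e =>
      Subtype.ext (hh.2 _ _ (congrArg Subtype.val e) fun e => x.2 ((hh.1 _).1 e))⟩
  invFun e := ⟨fun x => if hx : x = a ∨ x = b then z else e ⟨x, hx⟩, by
    simp only [collisionFunctions, Finset.mem_filter, Finset.mem_univ, true_and]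
    refine ⟨fun i => ?_, fun i j => ?_⟩
    · by_cases hi : i = a ∨ i = b
      · simp [hi]
      · simpa [hi] using (e ⟨i, hi⟩).2
    · by_cases hi : i = a ∨ i = b
      · simp [hi]
      · by_cases hj : j = a ∨ j = b
        · intro h h'
          simp only [hi, hj, dite_true, dite_false] at h h'
          exact absurd h h'
        · intro h _
          simp only [hi, hj, dite_false] at h
          exact congrArg Subtype.val (e.injective (Subtype.ext h))⟩
  left_inv h := by
    have hh := (Finset.mem_filter.1 h.2).2
    ext x
    by_cases hx : x = a ∨ x = b
    · simp [hx, (hh.1 x).2 hx]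
    · simp only [hx, dite_false]
      rfl
  right_inv e := by
    ext x
    simp [x.2]

theorem card_collisionFunctions {n : ℕ} (hn : 2 ≤ n) (z a b : Fin n) (hab : a ≠ b) :
    (collisionFunctions z a b).card = (n - 1).factorial := by
  have hα : Fintype.card {x : Fin n // ¬(x = a ∨ x = b)} = n - 2 := by
    rw [Fintype.card_subtype_compl, Fintype.card_fin, Fintype.card_subtype,
      ← Finset.card_pair hab]
    congr 2
    ext x
    simp
  have hβ : Fintype.card {y : Fin n // y ≠ z} = n - 1 := by
    rw [Fintype.card_subtype_compl, Fintype.card_fin, Fintype.card_subtype_eq]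
  rw [← Fintype.card_coe, Fintype.card_congr (collisionFunctionsEquiv z a b),
    Fintype.card_embedding_eq, hα, hβ]
  obtain ⟨k, rfl⟩ := Nat.exists_eq_add_of_le' hn
  have := Nat.factorial_mul_descFactorial (Nat.le_succ k)
  simpa using this

theorem Fin.card_filter_odd_succ (m : ℕ) :
    (Finset.univ.filter fun i : Fin (m + m) => Odd (i.val + 1)).card = m := by
  have : (Finset.univ.filter fun i : Fin (m + m) => Odd (i.val + 1)) =
      Finset.univ.image fun j : Fin m => (⟨2 * j.val, by omega⟩ : Fin (m + m)) := by
    ext i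
    simp only [Finset.mem_filter, Finset.mem_univ, true_and, Finset.mem_image, Fin.ext_iff]
    constructor
    · rintro ⟨k, hk⟩
      exact ⟨⟨k, by omega⟩, by simp only; omega⟩
    · rintro ⟨k, hk⟩
      exact ⟨k, by omega⟩
  rw [this, Finset.card_image_of_injective, Finset.card_univ, Fintype.card_fin]
  intro i j h
  simp only [Fin.mk.injEq] at h
  omega

theorem Fin.card_filter_even_succ (m : ℕ) :
    (Finset.univ.filter fun i : Fin (m + m) => Even (i.val + 1)).card = m := by
  have h := Finset.card_filter_add_card_filter_not (s := (Finset.univ : Finset (Fin (m + m))))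
    (fun i => Odd (i.val + 1))
  simp only [Nat.not_odd_iff_even, Fin.card_filter_odd_succ, Finset.card_univ,
    Fintype.card_fin] at h
  omega

theorem mem_Qset_iff {n : ℕ} (hn : 0 < n) (h : Fin n → Fin n) :
    h ∈ Qset n hn ↔ ∃ a b : Fin n, Odd (a.val + 1) ∧ Even (b.val + 1) ∧
      h ∈ collisionFunctions (⟨0, hn⟩ : Fin n) a b := by
  simp only [Qset, collisionFunctions, Finset.mem_filter, Finset.mem_univ, true_and]
  constructor
  · rintro ⟨h2, h1, hinj⟩
    obtain ⟨a, ha⟩ := Finset.card_eq_one.1 h1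
    have ha' : h a = ⟨0, hn⟩ ∧ Odd (a.val + 1) := by
      have := Finset.mem_singleton_self a
      rw [← ha] at this
      simpa using this
    have hmem : a ∈ Finset.univ.filter fun i => h i = (⟨0, hn⟩ : Fin n) := by
      simpa using ha'.1
    have hb1 := Finset.card_erase_of_mem hmem
    rw [h2] at hb1
    obtain ⟨b, hb⟩ := Finset.card_eq_one.1 hb1
    have hb' : b ≠ a ∧ h b = ⟨0, hn⟩ := by
      have := Finset.mem_singleton_self b
      rw [← hb] at this
      simpa using this
    refine ⟨a, b, ha'.2, ?_, fun i => ?_, fun i j hij hi => ?_⟩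
    · rw [← Nat.not_odd_iff_even]
      intro hodd
      have : b ∈ ({a} : Finset (Fin n)) := by
        rw [← ha]
        simpa using ⟨hb'.2, hodd⟩
      exact hb'.1 (Finset.mem_singleton.1 this)
    · constructor
      · intro hi
        by_cases hia : i = a
        · exact Or.inl hia
        · have : i ∈ ({b} : Finset (Fin n)) := by
            rw [← hb]
            simpa using ⟨hia, hi⟩
          exact Or.inr (Finset.mem_singleton.1 this)
      · rintro (rfl | rfl)
        exacts [ha'.1, hb'.2]
    · exact Finset.card_le_one.1 (hinj _ hi) i (by simp) j (by simp [hij])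
  · rintro ⟨a, b, ha, hb, hfib, hinj⟩
    have hab : a ≠ b := by
      rintro rfl
      exact Nat.not_even_iff_odd.2 ha hb
    refine ⟨?_, ?_, fun y hy => ?_⟩
    · rw [← Finset.card_pair hab]
      congr 1
      ext i
      simp [hfib]
    · rw [Finset.card_eq_one]
      refine ⟨a, ?_⟩
      ext i
      simp only [hfib, Finset.mem_filter, Finset.mem_univ, true_and, Finset.mem_singleton]
      constructor
      · rintro ⟨rfl | rfl, hi⟩
        · rfl
        · exact absurd hb (Nat.not_even_iff_odd.2 hi)
      · rintro rfl
        exact ⟨Or.inl rfl, ha⟩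
    · rw [Finset.card_le_one]
      intro i hi j hj
      simp only [Finset.mem_filter, Finset.mem_univ, true_and] at hi hj
      exact hinj i j (hi.trans hj.symm) (hi ▸ hy)

/-- For an even positive integer `n`, the set `Q` has exactly
`(n/2)² · (n−1)!` elements. -/
theorem card_Qset (n : ℕ) (hn : 0 < n) (hne : Even n) :
    (Qset n hn).card = (n / 2) ^ 2 * (n - 1).factorial := by
  obtain ⟨m, rfl⟩ := hne
  have hQ : Qset (m + m) hn =
      ((Finset.univ.filter fun i : Fin (m + m) => Odd (i.val + 1)) ×ˢ
        (Finset.univ.filter fun i : Fin (m + m) => Even (i.val + 1))).biUnion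
        fun p => collisionFunctions ⟨0, hn⟩ p.1 p.2 := by
    ext h
    simp [mem_Qset_iff]
  rw [hQ, Finset.card_biUnion, Finset.sum_const_nat (m := (m + m - 1).factorial),
    Finset.card_product, Fin.card_filter_odd_succ, Fin.card_filter_even_succ, ← sq,
    show (m + m) / 2 = m by omega]
  · rintro ⟨a, b⟩ hp
    simp only [Finset.mem_product, Finset.mem_filter, Finset.mem_univ, true_and] at hp
    refine card_collisionFunctions (by omega) _ _ _ ?_
    intro (e : a = b)
    exact Nat.not_even_iff_odd.2 hp.1 (e ▸ hp.2)
  · rintro ⟨a, b⟩ hp ⟨c, d⟩ hq hne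
    simp only [Finset.mem_coe, Finset.mem_product, Finset.mem_filter, Finset.mem_univ, true_and] at hp hq
    rw [Function.onFun, Finset.disjoint_left]
    intro h h₁ h₂
    simp only [collisionFunctions, Finset.mem_filter, Finset.mem_univ, true_and] at h₁ h₂
    have hiff : ∀ i, (i = a ∨ i = b) ↔ (i = c ∨ i = d) := fun i =>
      (h₁.1 i).symm.trans (h₂.1 i)
    refine hne (Prod.ext ?_ ?_)
    · rcases (hiff a).1 (Or.inl rfl) with e | e
      · exact e
      · exact absurd (e ▸ hq.2) (Nat.not_even_iff_odd.2 hp.1)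
    · rcases (hiff b).1 (Or.inr rfl) with e | e
      · exact absurd (e ▸ hp.2) (Nat.not_even_iff_odd.2 hq.1)
      · exact e
end

section
/- Let n be an even positive integer. If π is picked uniformly at random from P0, and then h is picked uniformly at random from Q_π, then h is uniformly distributed over Q; that is, the probability distribution obtained by first sampling π uniformly from P0 and then sampling h uniformly from Q_π equals the uniform distribution on Q. The same holds with P0 replaced by P1. -/
/-- `h` has a unique collision, at the value `z`, and the colliding pair consists of an element
satisfying `p` and an element not satisfying `p`. -/
def HasUniqueCollision {α : Type*} (p : α → Prop) (z : α) (h : α → α) : Prop :=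
  ∃ a b, p a ∧ ¬ p b ∧ h a = z ∧ h b = z ∧ (∀ i, h i = z → i = a ∨ i = b) ∧
    ∀ i j, h i = h j → h i ≠ z → i = j

theorem HasUniqueCollision.compl {α : Type*} {p q : α → Prop} {z : α} {h : α → α}
    (hpq : ∀ i, q i ↔ ¬ p i) (hh : HasUniqueCollision p z h) : HasUniqueCollision q z h := by
  obtain ⟨a, b, ha, hb, haz, hbz, hz, hinj⟩ := hh
  exact ⟨b, a, (hpq b).2 hb, fun hq => (hpq a).1 hq ha, hbz, haz,
    fun i hi => (hz i hi).symm, hinj⟩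

theorem mem_Qset_iff_s6 {n : ℕ} {hn : 0 < n} {h : Fin n → Fin n} :
    h ∈ Qset n hn ↔ HasUniqueCollision (fun i => Odd (i.val + 1)) ⟨0, hn⟩ h := by
  simp only [Qset, Finset.mem_filter, Finset.mem_univ, true_and]
  constructor
  · rintro ⟨h2, h1, hle⟩
    obtain ⟨a, ha⟩ := Finset.card_eq_one.1 h1
    have ha' : ∀ i, (h i = ⟨0, hn⟩ ∧ Odd (i.val + 1)) ↔ i = a := fun i => by
      simpa using Finset.ext_iff.1 ha i
    obtain ⟨haz, hao⟩ := (ha' a).2 rfl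
    obtain ⟨b, hba, hb'⟩ : ∃ b, b ≠ a ∧ ∀ i, h i = ⟨0, hn⟩ ↔ i = a ∨ i = b := by
      obtain ⟨x, y, hxy, hset⟩ := Finset.card_eq_two.1 h2
      have hmem : ∀ i, h i = ⟨0, hn⟩ ↔ i = x ∨ i = y := fun i => by
        simpa using Finset.ext_iff.1 hset i
      rcases (hmem a).1 haz with rfl | rfl
      · exact ⟨y, hxy.symm, hmem⟩
      · exact ⟨x, hxy, fun i => (hmem i).trans or_comm⟩
    have hbz := (hb' b).2 (Or.inr rfl)
    refine ⟨a, b, hao, fun hbo => hba ((ha' b).1 ⟨hbz, hbo⟩), haz, hbz,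
      fun i => (hb' i).1, fun i j hij hi => ?_⟩
    exact Finset.card_le_one.1 (hle (h i) hi) i (by simp) j (by simp [hij])
  · rintro ⟨a, b, ha, hb, haz, hbz, hz, hinj⟩
    have hab : a ≠ b := fun e => hb (e ▸ ha)
    refine ⟨Finset.card_eq_two.2 ⟨a, b, hab, ?_⟩, Finset.card_eq_one.2 ⟨a, ?_⟩, fun y hy => ?_⟩
    · ext i
      simp only [Finset.mem_filter, Finset.mem_univ, true_and, Finset.mem_insert,
        Finset.mem_singleton]
      exact ⟨hz i, by rintro (rfl | rfl) <;> assumption⟩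
    · ext i
      simp only [Finset.mem_filter, Finset.mem_univ, true_and, Finset.mem_singleton]
      refine ⟨fun ⟨hi, ho⟩ => (hz i hi).resolve_right ?_, by rintro rfl; exact ⟨haz, ha⟩⟩
      rintro rfl
      exact hb ho
    · refine Finset.card_le_one.2 fun i hi j hj => ?_
      simp only [Finset.mem_filter, Finset.mem_univ, true_and] at hi hj
      exact hinj i j (hi.trans hj.symm) (hi ▸ hy)

theorem card_filter_ne_eq_one_iff {α β : Type*} [Fintype α] [DecidableEq α] [DecidableEq β]
    {f g : α → β} :
    (Finset.univ.filter fun i => f i ≠ g i).card = 1 ↔ ∃ x, ∀ i, f i ≠ g i ↔ i = x := by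
  simp [Finset.card_eq_one, Finset.ext_iff]

section Permutations

variable {α : Type*} [DecidableEq α] {p : α → Prop} {z : α}

theorem hasUniqueCollision_and_differ_iff {π : Equiv.Perm α} (hπ : p (π.symm z)) {h : α → α} :
    (HasUniqueCollision p z h ∧ ∃ x, ∀ i, h i ≠ π i ↔ i = x) ↔
      ∃ b, ¬ p b ∧ Function.update π b z = h := by
  constructor
  · rintro ⟨⟨a, b, ha, hb, haz, hbz, hz, hinj⟩, x, hx⟩
    have hab : a ≠ b := fun e => hb (e ▸ ha)
    have hbx : b = x := by
      refine (hx b).1 fun e => hb ?_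
      rwa [← hbz, e, Equiv.symm_apply_apply] at hπ
    subst hbx
    refine ⟨b, hb, funext fun i => ?_⟩
    by_cases hi : i = b
    · subst hi
      simp [hbz]
    · rw [Function.update_of_ne hi]
      exact (not_not.1 (mt (hx i).1 hi)).symm
  · rintro ⟨b, hb, rfl⟩
    have hne : π.symm z ≠ b := fun e => hb (e ▸ hπ)
    have hbz : π b ≠ z := fun e => hne (by simp [← e])
    refine ⟨⟨π.symm z, b, hπ, hb, by simp [Function.update_of_ne hne], by simp,
      fun i hi => ?_, fun i j hij hi => ?_⟩, b, fun i => ?_⟩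
    · by_cases hib : i = b
      · exact Or.inr hib
      · rw [Function.update_of_ne hib] at hi
        exact Or.inl (by simp [← hi])
    · have hib : i ≠ b := by
        rintro rfl
        simp at hi
      have hjb : j ≠ b := by
        rintro rfl
        rw [hij] at hi
        simp at hi
      simpa [Function.update_of_ne hib, Function.update_of_ne hjb] using hij
    · by_cases hib : i = b
      · subst hib
        simpa using hbz.symm
      · simp [hib]

theorem existsUnique_perm_of_hasUniqueCollision [Finite α] {h : α → α}
    (hh : HasUniqueCollision p z h) :
    ∃! π : Equiv.Perm α, p (π.symm z) ∧ ∃ x, ∀ i, h i ≠ π i ↔ i = x := by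
  have hh' := hh
  obtain ⟨a, b, ha, hb, haz, hbz, hz, hinj⟩ := hh
  have hab : a ≠ b := fun e => hb (e ▸ ha)
  obtain ⟨c, hc⟩ : ∃ c, ∀ i, h i ≠ c := by
    by_contra! hsurj
    exact hab (Finite.injective_iff_surjective.2 hsurj (haz.trans hbz.symm))
  have hbij : Function.Bijective (Function.update h b c) := by
    refine Finite.injective_iff_bijective.1 fun i j hij => ?_
    by_cases hi : i = b <;> by_cases hj : j = b
    · exact hi.trans hj.symm
    · subst hi
      rw [Function.update_self, Function.update_of_ne hj] at hij
      exact absurd hij.symm (hc j)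
    · subst hj
      rw [Function.update_self, Function.update_of_ne hi] at hij
      exact absurd hij (hc i)
    · rw [Function.update_of_ne hi, Function.update_of_ne hj] at hij
      by_cases hiz : h i = z
      · rw [(hz i hiz).resolve_right hi, (hz j (hij ▸ hiz)).resolve_right hj]
      · exact hinj i j hij hiz
  refine ⟨Equiv.ofBijective _ hbij, ⟨?_, b, fun i => ?_⟩, ?_⟩
  · have : (Equiv.ofBijective _ hbij).symm z = a := by
      rw [Equiv.symm_apply_eq, Equiv.ofBijective_apply, Function.update_of_ne hab, haz]
    rwa [this]
  · rw [Equiv.ofBijective_apply]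
    by_cases hib : i = b
    · subst hib
      simpa using hc i
    · simp [hib]
  · rintro π ⟨hπ, hx⟩
    obtain ⟨b', hb', rfl⟩ := (hasUniqueCollision_and_differ_iff hπ).1 ⟨hh', hx⟩
    obtain rfl : b = b' :=
      ((hz b' (by simp)).resolve_left fun e => hb' (e ▸ ha)).symm
    have hπc : π b = c := by
      obtain ⟨j, hj⟩ := π.surjective c
      by_cases hjb : j = b
      · rwa [← hjb]
      · exact absurd ((Function.update_of_ne hjb z π).trans hj) (hc j)
    ext i
    simp [← hπc]

theorem card_image_update_perm [Fintype α] [DecidablePred p] {π : Equiv.Perm α}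
    (hπ : p (π.symm z)) :
    ((Finset.univ.filter fun b => ¬ p b).image fun b => Function.update π b z).card =
      (Finset.univ.filter fun b => ¬ p b).card := by
  refine Finset.card_image_of_injOn fun b hb b' _ hbb' => ?_
  have hb : ¬ p b := by simpa using hb
  by_contra hne
  have := congrFun hbb' b
  simp only [Function.update_self, Function.update_of_ne hne] at this
  exact hb (by rwa [this, Equiv.symm_apply_apply] at hπ)

end Permutations

/-- In a bipartite relation where every left vertex has `k` neighbours and every right vertex has
exactly one neighbour, a uniform neighbour of a uniform left vertex is a uniform right vertex. -/
theorem sum_uniform_neighbour {α β : Type*} [DecidableEq β] (P : Finset α) (Q : Finset β)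
    (N : α → Finset β) (k : ℕ) (hN : ∀ x ∈ P, N x ⊆ Q) (hk : ∀ x ∈ P, (N x).card = k)
    (huniq : ∀ y ∈ Q, ∃! x, x ∈ P ∧ y ∈ N x) (y : β) :
    ∑ x ∈ P, ((P.card : ℝ)⁻¹ * (if y ∈ N x then ((N x).card : ℝ)⁻¹ else 0)) =
      if y ∈ Q then (Q.card : ℝ)⁻¹ else 0 := by
  classical
  have hone : ∀ y ∈ Q, (P.filter fun x => y ∈ N x).card = 1 := fun y hy => by
    obtain ⟨x, hx, hx'⟩ := huniq y hy
    refine Finset.card_eq_one.2 ⟨x, Finset.ext fun w => ?_⟩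
    simp only [Finset.mem_filter, Finset.mem_singleton]
    exact ⟨hx' w, by rintro rfl; exact hx⟩
  have hcard : Q.card = P.card * k := by
    have := Finset.sum_card_bipartiteAbove_eq_sum_card_bipartiteBelow (s := P) (t := Q)
      (fun x y => y ∈ N x)
    simp only [Finset.bipartiteAbove, Finset.bipartiteBelow] at this
    rw [Finset.sum_congr rfl hone, Finset.sum_congr rfl fun x hx => by
      rw [Finset.filter_mem_eq_inter, Finset.inter_eq_right.2 (hN x hx), hk x hx]] at this
    simpa using this.symm
  rw [← Finset.mul_sum, ← Finset.sum_filter, Finset.sum_congr rfl fun x hx => by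
    rw [hk x (Finset.mem_filter.1 hx).1], Finset.sum_const]
  split_ifs with hy
  · rw [hone y hy, hcard, one_smul, Nat.cast_mul, mul_inv]
  · rw [Finset.filter_eq_empty_iff.2 fun x hx hyx => hy (hN x hx hyx)]
    simp

theorem uniform_Qset_of_uniform_perm {n : ℕ} (hn : 0 < n) (p : Fin n → Prop) [DecidablePred p]
    (hQ : ∀ h, h ∈ Qset n hn ↔ HasUniqueCollision p ⟨0, hn⟩ h)
    (P : Finset (Equiv.Perm (Fin n))) (hP : ∀ π, π ∈ P ↔ p (π.symm ⟨0, hn⟩))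
    (h : Fin n → Fin n) :
    ∑ π ∈ P, ((P.card : ℝ)⁻¹ *
        (if h ∈ Qpi n hn π then ((Qpi n hn π).card : ℝ)⁻¹ else 0)) =
      if h ∈ Qset n hn then ((Qset n hn).card : ℝ)⁻¹ else 0 := by
  have hmem : ∀ π h, h ∈ Qpi n hn π ↔
      HasUniqueCollision p ⟨0, hn⟩ h ∧ ∃ x, ∀ i, h i ≠ π i ↔ i = x := fun π h => by
    rw [Qpi, Finset.mem_filter, hQ, card_filter_ne_eq_one_iff]
  refine sum_uniform_neighbour P (Qset n hn) (Qpi n hn) (Finset.univ.filter fun b => ¬ p b).card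
    (fun π _ => Finset.filter_subset _ _) (fun π hπ => ?_) (fun h hh => ?_) h
  · rw [hP] at hπ
    rw [← card_image_update_perm hπ]
    congr 1
    ext h
    rw [hmem, hasUniqueCollision_and_differ_iff hπ]
    simp
  · have hc := (hQ h).1 hh
    simpa only [hP, hmem, hc, true_and] using existsUnique_perm_of_hasUniqueCollision hc

/-- For an even positive integer `n`: picking `π` uniformly from `P0` and then
`h` uniformly from `Q_π` produces a uniformly distributed `h` in `Q`. Stated
pointwise: for every function `h : [n] → [n]`, the resulting probability of `h`,
namely `∑ π ∈ P0, |P0|⁻¹ · (|Q_π|⁻¹ if h ∈ Q_π else 0)`, equals the uniform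
probability `|Q|⁻¹` if `h ∈ Q` and `0` otherwise. The same holds with `P0`
replaced by `P1`. -/
theorem uniform_Q_of_uniform_P0_P1 (n : ℕ) (hn : 0 < n) (hne : Even n) :
    (∀ h : Fin n → Fin n,
      ∑ π ∈ P0 n hn, (((P0 n hn).card : ℝ)⁻¹ *
          (if h ∈ Qpi n hn π then ((Qpi n hn π).card : ℝ)⁻¹ else 0)) =
        (if h ∈ Qset n hn then ((Qset n hn).card : ℝ)⁻¹ else 0)) ∧
    (∀ h : Fin n → Fin n,
      ∑ π ∈ P1 n hn, (((P1 n hn).card : ℝ)⁻¹ *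
          (if h ∈ Qpi n hn π then ((Qpi n hn π).card : ℝ)⁻¹ else 0)) =
        (if h ∈ Qset n hn then ((Qset n hn).card : ℝ)⁻¹ else 0)) := by
  have hpar : ∀ i : Fin n, Even (i.val + 1) ↔ ¬ Odd (i.val + 1) := fun i =>
    Nat.not_odd_iff_even.symm
  refine ⟨uniform_Qset_of_uniform_perm hn (fun i => Odd (i.val + 1)) (fun h => mem_Qset_iff_s6) _
      fun π => by simp [P0],
    uniform_Qset_of_uniform_perm hn (fun i => Even (i.val + 1)) (fun h => ?_) _
      fun π => by simp [P1]⟩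
  rw [mem_Qset_iff_s6]
  exact ⟨.compl hpar, .compl fun i => by rw [hpar i, not_not]⟩
end

section
/- Let n be an even positive integer, let π ∈ P0, and let f : [n/2] → {0,1}. If f⁻¹(1) is empty then h_{π,f} = π, and if f⁻¹(1) has exactly one element then h_{π,f} ∈ Q_π. -/
/-- `h_{π,f}` for a permutation `π` of `[n]` (`n` even) and `f : [n/2] → {0,1}`.
If `π ∈ P0` (i.e. `π⁻¹(1)` is odd): `h_{π,f}(i) = 1` if `i` is even and
`f(i/2) = 1`, and `h_{π,f}(i) = π(i)` otherwise.  If `π ∈ P1`: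
`h_{π,f}(i) = 1` if `i` is odd and `f((i+1)/2) = 1`, and `h_{π,f}(i) = π(i)`
otherwise.  (Recall `i : Fin n` represents the integer `i.val + 1`, so the
element `i/2` of `[n/2]` has index `(i.val+1)/2 - 1`, and `(i+1)/2` has index
`(i.val+2)/2 - 1`.) -/
def hpf (n : ℕ) (hn : 0 < n) (hne : Even n) (π : Equiv.Perm (Fin n))
    (f : Fin (n / 2) → Fin 2) : Fin n → Fin n := fun i =>
  if Odd ((π.symm ⟨0, hn⟩ : Fin n).val + 1) then
    -- the case π ∈ P0
    if Even (i.val + 1) ∧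
        f ⟨(i.val + 1) / 2 - 1, by
          have h1 := i.isLt; have h2 := Nat.even_iff.mp hne; omega⟩ = 1 then
      ⟨0, hn⟩
    else π i
  else
    -- the case π ∈ P1
    if Odd (i.val + 1) ∧
        f ⟨(i.val + 1 + 1) / 2 - 1, by
          have h1 := i.isLt; have h2 := Nat.even_iff.mp hne; omega⟩ = 1 then
      ⟨0, hn⟩
    else π i

/-- The 'yes' instances of `UniqueSearch_m`: functions `f : [m] → {0,1}`
mapping exactly one element to `1`. -/
def YesInst (m : ℕ) : Finset (Fin m → Fin 2) :=
  Finset.univ.filter fun f => (Finset.univ.filter fun x => f x = 1).card = 1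

/-- If `π⁻¹(1)` is odd and `j` is even, then redirecting `j` to `1` turns `π` into an element
of `Q_π`. -/
theorem update_mem_Qpi {n : ℕ} (hn : 0 < n) (π : Equiv.Perm (Fin n))
    (hπ : Odd ((π.symm ⟨0, hn⟩ : Fin n).val + 1)) (j : Fin n) (hj : Even (j.val + 1)) :
    Function.update (⇑π) j ⟨0, hn⟩ ∈ Qpi n hn π := by
  simp only [Qpi, Qset, Finset.mem_filter, Finset.mem_univ, true_and]
  generalize (⟨0, hn⟩ : Fin n) = z at hπ ⊢
  have hne : π.symm z ≠ j := by
    intro h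
    rw [h] at hπ
    exact Nat.not_even_iff_odd.mpr hπ hj
  have hπj : π j ≠ z := fun h => hne (by rw [← h, Equiv.symm_apply_apply])
  have hfiber (i : Fin n) : Function.update (⇑π) j z i = z ↔ i = π.symm z ∨ i = j := by
    rcases eq_or_ne i j with rfl | hi
    · simp
    · simp [hi, Equiv.eq_symm_apply]
  refine ⟨⟨?_, ?_, fun y hy => ?_⟩, ?_⟩
  · rw [Finset.card_eq_two]
    exact ⟨π.symm z, j, hne, by ext i; simp [hfiber]⟩
  · rw [Finset.card_eq_one]
    refine ⟨π.symm z, ?_⟩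
    ext i
    simp only [hfiber, Finset.mem_filter, Finset.mem_univ, true_and, Finset.mem_singleton]
    constructor
    · rintro ⟨rfl | rfl, hodd⟩
      · rfl
      · exact absurd hj (Nat.not_even_iff_odd.mpr hodd)
    · rintro rfl
      exact ⟨Or.inl rfl, hπ⟩
  · rw [Finset.card_le_one]
    have hval (i : Fin n) (hi : Function.update (⇑π) j z i = y) : π i = y := by
      rcases eq_or_ne i j with rfl | hij
      · exact absurd (by simpa using hi.symm) hy
      · simpa [hij] using hi
    intro a ha b hb
    simp only [Finset.mem_filter, Finset.mem_univ, true_and] at ha hb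
    exact π.injective ((hval a ha).trans (hval b hb).symm)
  · rw [Finset.card_eq_one]
    refine ⟨j, ?_⟩
    ext i
    rcases eq_or_ne i j with rfl | hi
    · simpa using hπj.symm
    · simp [hi]

/-- If `π⁻¹(1)` is odd and `f⁻¹(1) = {a}`, then `h_{π,f}` is `π` with the `a`-th even element
redirected to `1`. -/
theorem hpf_eq_update {n : ℕ} (hn : 0 < n) (hne : Even n) (π : Equiv.Perm (Fin n))
    (hπ : Odd ((π.symm ⟨0, hn⟩ : Fin n).val + 1)) (f : Fin (n / 2) → Fin 2) (a : Fin (n / 2))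
    (hf : ∀ x, f x = 1 ↔ x = a) :
    hpf n hn hne π f = Function.update (⇑π) ⟨2 * a.val + 1, by omega⟩ ⟨0, hn⟩ := by
  funext i
  simp only [hpf, if_pos hπ, hf, Function.update_apply]
  refine if_congr ?_ rfl rfl
  simp only [Fin.ext_iff, Nat.even_iff]
  omega

/-- For an even positive integer `n`, `π ∈ P0`, and `f : [n/2] → {0,1}`:
if `f⁻¹(1)` is empty then `h_{π,f} = π`, and if `f⁻¹(1)` has exactly one
element then `h_{π,f} ∈ Q_π`. -/
theorem hpf_P0_cases (n : ℕ) (hn : 0 < n) (hne : Even n)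
    (π : Equiv.Perm (Fin n)) (hπ : π ∈ P0 n hn) (f : Fin (n / 2) → Fin 2) :
    ((∀ x, f x ≠ 1) → hpf n hn hne π f = ⇑π) ∧
    ((Finset.univ.filter fun x => f x = 1).card = 1 →
      hpf n hn hne π f ∈ Qpi n hn π) := by
  simp only [P0, Finset.mem_filter, Finset.mem_univ, true_and] at hπ
  refine ⟨fun hf => ?_, fun hf => ?_⟩
  · funext i
    simp [hpf, hπ, hf]
  · obtain ⟨a, ha⟩ := Finset.card_eq_one.mp hf
    have hfa (x : Fin (n / 2)) : f x = 1 ↔ x = a := by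
      simpa using Finset.ext_iff.mp ha x
    rw [hpf_eq_update hn hne π hπ f a hfa]
    refine update_mem_Qpi hn π hπ _ ⟨a.val + 1, ?_⟩
    simp only
    omega
end

section
/- Let n be an even positive integer. Then the map (π, f) ↦ h_{π,f} is a bijection from the Cartesian product of P0 with the set of 'yes' instances of UniqueSearch_{n/2} onto Q, and likewise the map (π, f) ↦ h_{π,f} is a bijection from the Cartesian product of P1 with the set of 'yes' instances of UniqueSearch_{n/2} onto Q. -/
/-- The functions on `α` whose fibre over `z` consists of one point satisfying `p` and one point
violating it, and which are injective away from that fibre. -/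
def collisionAt {α : Type*} (p : α → Prop) (z : α) : Set (α → α) :=
  {h | ∃ a b, p a ∧ ¬ p b ∧ (∀ i, h i = z ↔ i = a ∨ i = b) ∧
    ∀ i j, h i = h j → h i ≠ z → i = j}

theorem collisionAt_not {α : Type*} (p : α → Prop) (z : α) :
    collisionAt (fun i => ¬ p i) z = collisionAt p z := by
  ext h
  constructor
  · rintro ⟨a, b, ha, hb, hab, hinj⟩
    exact ⟨b, a, not_not.mp hb, ha, fun i => (hab i).trans or_comm, hinj⟩
  · rintro ⟨a, b, ha, hb, hab, hinj⟩
    exact ⟨b, a, hb, not_not.mpr ha, fun i => (hab i).trans or_comm, hinj⟩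

theorem perm_eq_of_eq_off {α : Type*} {π σ : Equiv.Perm α} (b : α)
    (h : ∀ i, i ≠ b → π i = σ i) : π = σ := by
  ext i
  by_cases hi : i = b
  · subst hi
    obtain ⟨j, hj⟩ := σ.surjective (π i)
    by_cases hji : j = i
    · rw [← hj, hji]
    · exact absurd (π.injective ((h j hji).trans hj)) hji
  · exact h i hi

/-- A function with a single collision, between `a` and `b`, is a permutation modified at `b`. -/
theorem exists_perm_update {α : Type*} [Finite α] [DecidableEq α] {h : α → α} {z a b : α}
    (hne : a ≠ b) (hab : ∀ i, h i = z ↔ i = a ∨ i = b)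
    (hinj : ∀ i j, h i = h j → h i ≠ z → i = j) :
    ∃ π : Equiv.Perm α, π a = z ∧ Function.update π b z = h := by
  have ha : h a = z := (hab a).2 (Or.inl rfl)
  have hb : h b = z := (hab b).2 (Or.inr rfl)
  have hsurj : ¬ Function.Surjective h := fun hs =>
    hne (Finite.injective_iff_surjective.2 hs (ha.trans hb.symm))
  obtain ⟨c, hc⟩ := not_forall.1 hsurj
  have hc' : ∀ i, h i ≠ c := not_exists.1 hc
  have hbij : Function.Bijective (Function.update h b c) := by
    rw [← Finite.injective_iff_bijective]
    intro i j hij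
    by_cases hi : i = b <;> by_cases hj : j = b
    · rw [hi, hj]
    · subst hi
      rw [Function.update_self, Function.update_of_ne hj] at hij
      exact absurd hij.symm (hc' j)
    · subst hj
      rw [Function.update_self, Function.update_of_ne hi] at hij
      exact absurd hij (hc' i)
    · rw [Function.update_of_ne hi, Function.update_of_ne hj] at hij
      by_cases hz : h i = z
      · rw [((hab i).1 hz).resolve_right hi, ((hab j).1 (hij ▸ hz)).resolve_right hj]
      · exact hinj i j hij hz
  refine ⟨Equiv.ofBijective _ hbij, ?_, ?_⟩
  · rw [Equiv.ofBijective_apply, Function.update_of_ne hne, ha]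
  · rw [Equiv.coe_ofBijective, Function.update_idem, ← hb, Function.update_eq_self]

/-- Redirecting to `z` a point violating `p`, encoded by `c`, of a permutation whose preimage of
`z` satisfies `p` is a bijection onto the functions with a single collision at `z`. -/
theorem bijOn_collisionAt {α X : Type*} [Finite α] [DecidableEq α] (p : α → Prop) (z : α)
    {S : Set X} {c : α → X} (hc : Set.BijOn c {b | ¬ p b} S)
    {F : Equiv.Perm α × X → α → α}
    (hF : ∀ π : Equiv.Perm α, p (π.symm z) → ∀ b, ¬ p b →
      F (π, c b) = Function.update π b z) :
    Set.BijOn F ({π : Equiv.Perm α | p (π.symm z)} ×ˢ S) (collisionAt p z) := by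
  have hfib : ∀ (π : Equiv.Perm α) (b i : α),
      Function.update π b z i = z ↔ i = π.symm z ∨ i = b := by
    intro π b i
    by_cases hi : i = b
    · simp [hi]
    · rw [Function.update_of_ne hi, Equiv.eq_symm_apply]
      simp [hi]
  refine ⟨?_, ?_, ?_⟩
  · rintro ⟨π, x⟩ ⟨hπ, hx⟩
    obtain ⟨b, hb, rfl⟩ := hc.surjOn hx
    rw [hF π hπ b hb]
    refine ⟨π.symm z, b, hπ, hb, hfib π b, fun i j hij hi => ?_⟩
    have hib : i ≠ b := fun e => hi ((hfib π b i).2 (Or.inr e))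
    have hjb : j ≠ b := fun e => hi (hij.trans ((hfib π b j).2 (Or.inr e)))
    rw [Function.update_of_ne hib, Function.update_of_ne hjb] at hij
    exact π.injective hij
  · rintro ⟨π, x⟩ ⟨hπ, hx⟩ ⟨σ, y⟩ ⟨hσ, hy⟩ hxy
    obtain ⟨b, hb, rfl⟩ := hc.surjOn hx
    obtain ⟨d, hd, rfl⟩ := hc.surjOn hy
    rw [hF π hπ b hb, hF σ hσ d hd] at hxy
    have hbd : b = d := by
      have hbz := (hfib π b b).2 (Or.inr rfl)
      rw [hxy] at hbz
      exact ((hfib σ d b).1 hbz).resolve_left fun e => hb (e ▸ hσ)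
    subst hbd
    have hπσ : π = σ := perm_eq_of_eq_off b fun i hi => by
      simpa [Function.update_of_ne hi] using congrFun hxy i
    rw [hπσ]
  · rintro h ⟨a, b, ha, hb, hab, hinj⟩
    have hne : a ≠ b := fun e => hb (e ▸ ha)
    obtain ⟨π, hπa, rfl⟩ := exists_perm_update hne hab hinj
    have hπ : p (π.symm z) := by rwa [← hπa, Equiv.symm_apply_apply]
    exact ⟨(π, c b), ⟨hπ, hc.mapsTo hb⟩, hF π hπ b hb⟩

theorem coe_Qset (n : ℕ) (hn : 0 < n) :
    (↑(Qset n hn) : Set (Fin n → Fin n)) =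
      collisionAt (fun i : Fin n => Odd (i.val + 1)) ⟨0, hn⟩ := by
  ext h
  simp only [Qset, Finset.coe_filter, Finset.mem_univ, true_and, collisionAt, Set.mem_ofPred_eq]
  constructor
  · rintro ⟨h2, h1, hle⟩
    obtain ⟨a, ha⟩ := Finset.card_eq_one.1 h1
    obtain ⟨u, v, huv, huv'⟩ := Finset.card_eq_two.1 h2
    have ha' : ∀ i, (h i = ⟨0, hn⟩ ∧ Odd (i.val + 1)) ↔ i = a := fun i => by
      simpa using Finset.ext_iff.1 ha i
    have hfib : ∀ i, h i = ⟨0, hn⟩ ↔ i = u ∨ i = v := fun i => by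
      simpa using Finset.ext_iff.1 huv' i
    have hinj : ∀ i j, h i = h j → h i ≠ ⟨0, hn⟩ → i = j := fun i j hij hi =>
      Finset.card_le_one.1 (hle (h i) hi) i (by simp) j (by simp [hij])
    obtain ⟨haz, hao⟩ := (ha' a).2 rfl
    rcases (hfib a).1 haz with rfl | rfl
    · exact ⟨a, v, hao, fun hv => huv ((ha' v).1 ⟨(hfib v).2 (Or.inr rfl), hv⟩).symm,
        hfib, hinj⟩
    · exact ⟨a, u, hao, fun hu => huv ((ha' u).1 ⟨(hfib u).2 (Or.inl rfl), hu⟩),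
        fun i => (hfib i).trans or_comm, hinj⟩
  · rintro ⟨a, b, ha, hb, hab, hinj⟩
    have hne : a ≠ b := fun e => hb (e ▸ ha)
    refine ⟨Finset.card_eq_two.2 ⟨a, b, hne, ?_⟩, Finset.card_eq_one.2 ⟨a, ?_⟩, fun y hy => ?_⟩
    · ext i
      simp [hab]
    · ext i
      simp only [Finset.mem_filter, Finset.mem_univ, true_and, Finset.mem_singleton, hab]
      constructor
      · rintro ⟨rfl | rfl, hi⟩
        · rfl
        · exact absurd hi hb
      · rintro rfl
        exact ⟨Or.inl rfl, ha⟩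
    · refine Finset.card_le_one.2 fun i hi j hj => ?_
      simp only [Finset.mem_filter, Finset.mem_univ, true_and] at hi hj
      exact hinj i j (hi.trans hj.symm) (hi ▸ hy)

/-- The function `[n/2] → {0,1}` taking the value `1` exactly at the index of the pair
`{2k - 1, 2k}` containing the element represented by `b`. -/
def halfIndicator {n : ℕ} (b : Fin n) : Fin (n / 2) → Fin 2 :=
  fun x => if x.val = b.val / 2 then 1 else 0

theorem halfIndicator_eq_one_iff {n : ℕ} (b : Fin n) (x : Fin (n / 2)) :
    halfIndicator b x = 1 ↔ x.val = b.val / 2 := by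
  simp [halfIndicator]

/-- `halfIndicator` is a bijection onto the yes instances from any set that meets each pair
`{2k - 1, 2k}` exactly once. -/
theorem bijOn_halfIndicator {n : ℕ} (hne : Even n) {T : Set (Fin n)}
    (hinj : ∀ b ∈ T, ∀ d ∈ T, b.val / 2 = d.val / 2 → b = d)
    (hsurj : ∀ k < n / 2, ∃ b ∈ T, b.val / 2 = k) :
    Set.BijOn halfIndicator T (↑(YesInst (n / 2)) : Set (Fin (n / 2) → Fin 2)) := by
  have hlt : ∀ b : Fin n, b.val / 2 < n / 2 := fun b => by
    have := b.isLt
    have := Nat.even_iff.1 hne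
    omega
  refine ⟨fun b _ => ?_, fun b hb d hd hbd => ?_, fun f hf => ?_⟩
  · simp only [YesInst, Finset.coe_filter, Finset.mem_univ, true_and, Set.mem_ofPred_eq]
    refine Finset.card_eq_one.2 ⟨⟨b.val / 2, hlt b⟩, ?_⟩
    ext x
    rw [Finset.mem_filter_univ, Finset.mem_singleton, halfIndicator_eq_one_iff, Fin.ext_iff]
  · refine hinj b hb d hd ?_
    have h1 := (halfIndicator_eq_one_iff b ⟨b.val / 2, hlt b⟩).2 rfl
    rw [hbd] at h1
    exact (halfIndicator_eq_one_iff d _).1 h1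
  · simp only [YesInst, Finset.coe_filter, Finset.mem_univ, true_and, Set.mem_ofPred_eq] at hf
    obtain ⟨x, hx⟩ := Finset.card_eq_one.1 hf
    have hx' : ∀ y, f y = 1 ↔ y = x := fun y => by simpa using Finset.ext_iff.1 hx y
    obtain ⟨b, hb, hbx⟩ := hsurj x.val x.isLt
    refine ⟨b, hb, ?_⟩
    have key : ∀ y, halfIndicator b y = 1 ↔ f y = 1 := fun y => by
      rw [halfIndicator_eq_one_iff, hx', hbx, Fin.ext_iff]
    funext y
    have := key y
    omega

theorem hpf_halfIndicator_of_odd {n : ℕ} (hn : 0 < n) (hne : Even n) (π : Equiv.Perm (Fin n))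
    (hπ : Odd ((π.symm ⟨0, hn⟩ : Fin n).val + 1)) (b : Fin n) (hb : ¬ Odd (b.val + 1)) :
    hpf n hn hne π (halfIndicator b) = Function.update π b ⟨0, hn⟩ := by
  funext i
  simp only [hpf, if_pos hπ, halfIndicator_eq_one_iff, Function.update_apply]
  refine if_congr ?_ rfl rfl
  rw [Nat.not_odd_iff_even] at hb
  simp only [Nat.even_iff, Fin.ext_iff] at *
  omega

theorem hpf_halfIndicator_of_not_odd {n : ℕ} (hn : 0 < n) (hne : Even n)
    (π : Equiv.Perm (Fin n)) (hπ : ¬ Odd ((π.symm ⟨0, hn⟩ : Fin n).val + 1)) (b : Fin n)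
    (hb : Odd (b.val + 1)) :
    hpf n hn hne π (halfIndicator b) = Function.update π b ⟨0, hn⟩ := by
  funext i
  simp only [hpf, if_neg hπ, halfIndicator_eq_one_iff, Function.update_apply]
  refine if_congr ?_ rfl rfl
  simp only [Nat.odd_iff, Fin.ext_iff] at *
  omega

/-- For an even positive integer `n`, the map `(π, f) ↦ h_{π,f}` is a bijection
from `P0 × {yes instances of UniqueSearch_{n/2}}` onto `Q`, and likewise a
bijection from `P1 × {yes instances of UniqueSearch_{n/2}}` onto `Q`. -/
theorem hpf_bijOn_prod_Q (n : ℕ) (hn : 0 < n) (hne : Even n) :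
    Set.BijOn (fun p : Equiv.Perm (Fin n) × (Fin (n / 2) → Fin 2) =>
        hpf n hn hne p.1 p.2)
      ((↑(P0 n hn) : Set (Equiv.Perm (Fin n))) ×ˢ (↑(YesInst (n / 2))))
      (↑(Qset n hn)) ∧
    Set.BijOn (fun p : Equiv.Perm (Fin n) × (Fin (n / 2) → Fin 2) =>
        hpf n hn hne p.1 p.2)
      ((↑(P1 n hn) : Set (Equiv.Perm (Fin n))) ×ˢ (↑(YesInst (n / 2))))
      (↑(Qset n hn)) := by
  have hn2 := Nat.even_iff.1 hne
  constructor
  · have hP : (↑(P0 n hn) : Set (Equiv.Perm (Fin n))) =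
        {π | Odd ((π.symm ⟨0, hn⟩ : Fin n).val + 1)} := by
      simp [P0]
    rw [coe_Qset, hP]
    refine bijOn_collisionAt (fun i : Fin n => Odd (i.val + 1)) _
      (bijOn_halfIndicator hne ?_ ?_) (hpf_halfIndicator_of_odd hn hne)
    · intro b hb d hd hbd
      simp only [Set.mem_ofPred_eq, Nat.odd_iff] at hb hd
      exact Fin.ext (by omega)
    · intro k hk
      refine ⟨⟨2 * k + 1, by omega⟩, ?_, ?_⟩
      · simp only [Set.mem_ofPred_eq, Nat.odd_iff]
        omega
      · simp only
        omega
  · have hP : (↑(P1 n hn) : Set (Equiv.Perm (Fin n))) =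
        {π | ¬ Odd ((π.symm ⟨0, hn⟩ : Fin n).val + 1)} := by
      simp [P1]
    rw [coe_Qset, hP, ← collisionAt_not]
    refine bijOn_collisionAt (fun i : Fin n => ¬ Odd (i.val + 1)) _
      (bijOn_halfIndicator hne ?_ ?_)
      fun π hπ b hb => hpf_halfIndicator_of_not_odd hn hne π hπ b (not_not.1 hb)
    · intro b hb d hd hbd
      simp only [Set.mem_ofPred_eq, not_not, Nat.odd_iff] at hb hd
      exact Fin.ext (by omega)
    · intro k hk
      refine ⟨⟨2 * k, by omega⟩, ?_, ?_⟩
      · simp only [Set.mem_ofPred_eq, not_not, Nat.odd_iff]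
        omega
      · simp only
        omega
end

section
/- Let n be a positive integer and let π ∈ P1. Let ω be a uniformly random permutation of [n] with ω(1) = 1, and independently let σ be a uniformly random permutation of [n] that maps odd elements to odd elements and even elements to even elements. Then ω ∘ π ∘ σ is uniformly distributed over P1; equivalently, for any two τ, τ' ∈ P1, the number of pairs (ω, σ) of such permutations with ω ∘ π ∘ σ = τ equals the number of such pairs with ω ∘ π ∘ σ = τ'. The analogous statement holds with P1 replaced by P0 throughout. -/
/-- The permutations `ω` of `[n]` with `ω(1) = 1`. -/
def Wfix (n : ℕ) (hn : 0 < n) : Finset (Equiv.Perm (Fin n)) :=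
  Finset.univ.filter fun ω => ω ⟨0, hn⟩ = ⟨0, hn⟩

/-- The permutations `σ` of `[n]` mapping odd elements to odd elements and
even elements to even elements. -/
def Spar (n : ℕ) : Finset (Equiv.Perm (Fin n)) :=
  Finset.univ.filter fun σ => ∀ i : Fin n,
    (Odd (i.val + 1) → Odd ((σ i).val + 1)) ∧
    (Even (i.val + 1) → Even ((σ i).val + 1))

open Equiv in
/-- Left translation by a permutation fixing `1` and right translation by a parity-preserving
transposition turn factorizations of `τ` into ones of any permutation with `1` at a position of
the same parity. -/
theorem card_factorizations_le (n : ℕ) (hn : 0 < n) (π τ τ' : Perm (Fin n))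
    (h : Even ((τ.symm ⟨0, hn⟩ : Fin n).val + 1) ↔ Even ((τ'.symm ⟨0, hn⟩ : Fin n).val + 1)) :
    ((Wfix n hn ×ˢ Spar n).filter (fun p => (p.2.trans π).trans p.1 = τ)).card ≤
      ((Wfix n hn ×ˢ Spar n).filter (fun p => (p.2.trans π).trans p.1 = τ')).card := by
  set s : Perm (Fin n) := swap (τ.symm ⟨0, hn⟩) (τ'.symm ⟨0, hn⟩) with hs
  have hpar : ∀ i, Even ((s i).val + 1) ↔ Even (i.val + 1) := by
    intro i
    rw [hs, swap_apply_def]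
    split_ifs with h₁ h₂
    · rw [h₁, h]
    · rw [h₂, h]
    · rfl
  refine Finset.card_le_card_of_injOn (fun p => (τ' * s * τ⁻¹ * p.1, p.2 * s)) ?_ ?_
  · rintro ⟨ω, σ⟩ hp
    simp only [Wfix, Spar, Finset.coe_filter, Finset.mem_product, Finset.mem_filter,
      Finset.mem_univ, true_and, Set.mem_ofPred_eq] at hp ⊢
    obtain ⟨⟨hω, hσ⟩, hτ⟩ := hp
    refine ⟨⟨?_, fun i => ?_⟩, ?_⟩
    · simp [Perm.mul_apply, hω, hs, Perm.inv_def]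
    · have hi := hpar i
      have hi' := hσ (s i)
      simp only [Perm.mul_apply, ← Nat.not_even_iff_odd] at hi' ⊢
      tauto
    · change ω * (π * σ) = τ at hτ
      change τ' * s * τ⁻¹ * ω * (π * (σ * s)) = τ'
      calc τ' * s * τ⁻¹ * ω * (π * (σ * s)) = τ' * s * τ⁻¹ * (ω * (π * σ)) * s := by group
        _ = τ' * (s * s) := by rw [hτ]; group
        _ = τ' := by rw [hs, swap_mul_self, mul_one]
  · rintro ⟨ω₁, σ₁⟩ - ⟨ω₂, σ₂⟩ - hp
    simpa using hp

/-- The number of factorizations of `τ` depends only on the parity of `τ⁻¹(1)`. -/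
theorem card_factorizations_eq (n : ℕ) (hn : 0 < n) (π τ τ' : Equiv.Perm (Fin n))
    (h : Even ((τ.symm ⟨0, hn⟩ : Fin n).val + 1) ↔ Even ((τ'.symm ⟨0, hn⟩ : Fin n).val + 1)) :
    ((Wfix n hn ×ˢ Spar n).filter (fun p => (p.2.trans π).trans p.1 = τ)).card =
      ((Wfix n hn ×ˢ Spar n).filter (fun p => (p.2.trans π).trans p.1 = τ')).card :=
  (card_factorizations_le n hn π τ τ' h).antisymm (card_factorizations_le n hn π τ' τ h.symm)

/-- For `π ∈ P1`, with `ω` uniformly random among permutations fixing `1` and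
`σ` uniformly random among parity-preserving permutations, `ω ∘ π ∘ σ` is
uniformly distributed over `P1`: for any two `τ, τ' ∈ P1`, the number of pairs
`(ω, σ)` with `ω ∘ π ∘ σ = τ` equals the number of pairs with `ω ∘ π ∘ σ = τ'`.
The analogous statement holds with `P1` replaced by `P0` throughout. -/
theorem self_reduction_uniform (n : ℕ) (hn : 0 < n) :
    (∀ π ∈ P1 n hn, ∀ τ ∈ P1 n hn, ∀ τ' ∈ P1 n hn,
      ((Wfix n hn ×ˢ Spar n).filter
          (fun p => (p.2.trans π).trans p.1 = τ)).card =
      ((Wfix n hn ×ˢ Spar n).filter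
          (fun p => (p.2.trans π).trans p.1 = τ')).card) ∧
    (∀ π ∈ P0 n hn, ∀ τ ∈ P0 n hn, ∀ τ' ∈ P0 n hn,
      ((Wfix n hn ×ˢ Spar n).filter
          (fun p => (p.2.trans π).trans p.1 = τ)).card =
      ((Wfix n hn ×ˢ Spar n).filter
          (fun p => (p.2.trans π).trans p.1 = τ')).card) := by
  refine ⟨fun π _ τ hτ τ' hτ' => ?_, fun π _ τ hτ τ' hτ' => ?_⟩
  · simp only [P1, Finset.mem_filter, Finset.mem_univ, true_and] at hτ hτ'
    exact card_factorizations_eq n hn π τ τ' (iff_of_true hτ hτ')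
  · simp only [P0, Finset.mem_filter, Finset.mem_univ, true_and, ← Nat.not_even_iff_odd]
      at hτ hτ'
    exact card_factorizations_eq n hn π τ τ' (iff_of_false hτ hτ')
end
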